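/- Let G = K(m, 2) for m ≥ 5 and t ≥ 1. Then π_t(G) = p(m, t), where p(m, t) = max( C(m,2) + 2t − 2, 4t + 2m − 5 ). -/

import Mathlib

/-- A single pebbling step: remove two pebbles from `u` and add one to an adjacent `v`. -/
def PebblingStep {V : Type} [DecidableEq V] (G : SimpleGraph V) (C C' : V → ℕ) : Prop :=
  ∃ u v : V, G.Adj u v ∧ 2 ≤ C u ∧
    C' = fun w => if w = u then C u - 2 else if w = v then C v + 1 else C w

/-- `C` solves the target distribution `D`: some sequence of pebbling steps reaches a
configuration with at least `D v` pebbles on each vertex `v`. -/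
def Solvable {V : Type} [DecidableEq V] (G : SimpleGraph V) (C D : V → ℕ) : Prop :=
  ∃ C' : V → ℕ, Relation.ReflTransGen (PebblingStep G) C C' ∧ ∀ v, D v ≤ C' v

/-- The distribution with `t` pebbles stacked on `r` and none elsewhere. -/
def stack {V : Type} [DecidableEq V] (r : V) (t : ℕ) : V → ℕ :=
  fun v => if v = r then t else 0

/-- The pebbling number of the demand `D` in `G`: the smallest `m` such that every
configuration of size `m` is `D`-solvable. -/
noncomputable def pebblingNumber {V : Type} [Fintype V] [DecidableEq V] (G : SimpleGraph V) (D : V → ℕ) : ℕ :=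
  sInf {m | ∀ C : V → ℕ, (∑ v, C v) = m → Solvable G C D}

/-- The `t`-fold pebbling number of `G`. -/
noncomputable def tPebblingNumber {V : Type} [Fintype V] [DecidableEq V]
    (G : SimpleGraph V) (t : ℕ) : ℕ :=
  Finset.univ.sup fun r => pebblingNumber G (stack r t)

/-- Reaching `C'` from `C` by exactly `k` pebbling steps. -/
inductive StepsN {V : Type} [DecidableEq V] (G : SimpleGraph V) : ℕ → (V → ℕ) → (V → ℕ) → Prop
  | refl (C : V → ℕ) : StepsN G 0 C C
  | tail {k : ℕ} {C C' C'' : V → ℕ} :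
      StepsN G k C C' → PebblingStep G C' C'' → StepsN G (k + 1) C C''

/-- `C` has an `r`-solution of cost at most `c` (cost = number of pebbling steps plus one). -/
def CheaplySolvable {V : Type} [DecidableEq V] (G : SimpleGraph V) (C : V → ℕ) (r : V) (c : ℕ) : Prop :=
  ∃ (k : ℕ) (C' : V → ℕ), StepsN G k C C' ∧ 1 ≤ C' r ∧ k + 1 ≤ c

/-- The eccentricity of a vertex: the maximum distance to any other vertex. -/
noncomputable def eccentricity {V : Type} [Fintype V] (G : SimpleGraph V) (r : V) : ℕ :=
  Finset.univ.sup fun v => G.dist r v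

/-- A vertex is simplicial if its neighborhood induces a complete graph. -/
def IsSimplicial {V : Type} (G : SimpleGraph V) (v : V) : Prop :=
  ∀ a b : V, G.Adj v a → G.Adj v b → a ≠ b → G.Adj a b

/-- A 2-path is either `K₂` or `K₃`, or a graph with exactly two simplicial vertices
`u` and `v` such that the neighborhood of `v` induces `K₂` and `G - v` is a 2-path. -/
inductive IsTwoPath : {V : Type} → SimpleGraph V → Prop
  | complete2 {V : Type} (G : SimpleGraph V) :
      Nat.card V = 2 → (∀ a b : V, a ≠ b → G.Adj a b) → IsTwoPath G
  | complete3 {V : Type} (G : SimpleGraph V) :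
      Nat.card V = 3 → (∀ a b : V, a ≠ b → G.Adj a b) → IsTwoPath G
  | extend {V : Type} (G : SimpleGraph V) (u v : V) :
      u ≠ v →
      {w : V | IsSimplicial G w} = {u, v} →
      (G.neighborSet v).ncard = 2 →
      IsSimplicial G v →
      IsTwoPath (G.induce {w : V | w ≠ v}) →
      IsTwoPath G

/-- The Kneser graph `K(m, h)`: vertices are the `h`-element subsets of `{1, …, m}`,
adjacent iff disjoint. -/
def kneserGraph (m h : ℕ) : SimpleGraph {s : Finset (Fin m) // s.card = h} :=
  SimpleGraph.fromRel fun a b => Disjoint a.1 b.1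


/-- Reachability by pebbling steps. -/
abbrev Reaches {V : Type} [DecidableEq V] (G : SimpleGraph V) : (V → ℕ) → (V → ℕ) → Prop :=
  Relation.ReflTransGen (PebblingStep G)

section Moves

variable {V : Type} [DecidableEq V] {G : SimpleGraph V}

lemma pebblingStep_add_single {u v : V} (h : G.Adj u v) (E : V → ℕ) :
    PebblingStep G (E + Pi.single u 2) (E + Pi.single v 1) := by
  have huv := h.ne
  refine ⟨u, v, h, by simp, ?_⟩
  funext w
  by_cases hu : w = u
  · subst hu; simp [huv]
  · by_cases hv : w = v
    · subst hv; simp [hu]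
    · simp [hu, hv]

lemma reaches_add_single {u v : V} (h : G.Adj u v) (E : V → ℕ) :
    Reaches G (E + Pi.single u 2) (E + Pi.single v 1) :=
  .single (pebblingStep_add_single h E)

lemma single_one_add_single_one (w : V) :
    (Pi.single w 1 + Pi.single w 1 : V → ℕ) = Pi.single w 2 := by
  rw [← Pi.single_add]

lemma reaches_of_occupied {v w r : V} (hvw : G.Adj v w) (hwr : G.Adj w r) (E : V → ℕ) :
    Reaches G (E + Pi.single v 2 + Pi.single w 1) (E + Pi.single r 1) := by
  have h := reaches_add_single hvw (E + Pi.single w 1)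
  rw [add_assoc E _ (Pi.single w 1), single_one_add_single_one] at h
  rw [add_right_comm]
  exact h.trans (reaches_add_single hwr E)

lemma reaches_of_flip {v u w r : V} (hvu : G.Adj v u) (huw : G.Adj u w) (hwr : G.Adj w r)
    (E : V → ℕ) :
    Reaches G (E + Pi.single v 2 + Pi.single u 1 + Pi.single w 1) (E + Pi.single r 1) := by
  have h := reaches_of_occupied hvu huw (E + Pi.single w 1)
  rw [add_assoc E _ (Pi.single w 1), single_one_add_single_one] at h
  rw [add_right_comm, add_right_comm E]
  exact h.trans (reaches_add_single hwr E)

lemma reaches_of_two_pairs {v v' w r : V} (hv : G.Adj v w) (hv' : G.Adj v' w) (hwr : G.Adj w r)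
    (E : V → ℕ) :
    Reaches G (E + Pi.single v 2 + Pi.single v' 2) (E + Pi.single r 1) := by
  have h := reaches_add_single hv' (E + Pi.single v 2)
  exact h.trans (reaches_of_occupied hv hwr E)

lemma reaches_of_flip_of_pair {v v' u w r : V} (hvu : G.Adj v u) (huw : G.Adj u w)
    (hv' : G.Adj v' w) (hwr : G.Adj w r) (E : V → ℕ) :
    Reaches G (E + Pi.single v 2 + Pi.single v' 2 + Pi.single u 1) (E + Pi.single r 1) := by
  have h₁ := reaches_add_single hvu (E + Pi.single v' 2 + Pi.single u 1)
  have h₂ := reaches_of_two_pairs huw hv' hwr E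
  rw [show E + Pi.single v 2 + Pi.single v' 2 + Pi.single u 1 =
    E + Pi.single v' 2 + Pi.single u 1 + Pi.single v 2 by abel]
  rw [← single_one_add_single_one u, show E + (Pi.single u 1 + Pi.single u 1) + Pi.single v' 2 =
    E + Pi.single v' 2 + Pi.single u 1 + Pi.single u 1 by abel] at h₂
  exact h₁.trans h₂

lemma reaches_of_three_pairs {v₁ v₂ v₃ u w r : V} (h₁ : G.Adj v₁ u) (h₂ : G.Adj v₂ u)
    (huw : G.Adj u w) (h₃ : G.Adj v₃ w) (hwr : G.Adj w r) (E : V → ℕ) :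
    Reaches G (E + Pi.single v₁ 2 + Pi.single v₃ 2 + Pi.single v₂ 2) (E + Pi.single r 1) :=
  (reaches_add_single h₂ _).trans (reaches_of_flip_of_pair h₁ huw h₃ hwr E)

lemma exists_reaches_of_le {r : V} {C X : V → ℕ} (hle : X ≤ C) (hr : X r = 0)
    (h : ∀ E, Reaches G (E + X) (E + Pi.single r 1)) : ∃ C', Reaches G C C' ∧ C r < C' r := by
  have h' := h (C - X)
  rw [tsub_add_cancel_of_le hle] at h'
  exact ⟨_, h', by simp [hr]⟩

lemma single_add_single_le {a b : V} {i j : ℕ} {C : V → ℕ} (hab : a ≠ b) (ha : i ≤ C a)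
    (hb : j ≤ C b) : Pi.single a i + Pi.single b j ≤ C := by
  intro x
  simp only [Pi.add_apply, Pi.single_apply]
  split_ifs with h₁ h₂ h₂
  · exact absurd (h₁.symm.trans h₂) hab
  · simpa [h₁] using ha
  · simpa [h₂] using hb
  · simp

lemma single_add_single_add_single_le {a b c : V} {i j k : ℕ} {C : V → ℕ} (hab : a ≠ b)
    (hac : a ≠ c) (hbc : b ≠ c) (ha : i ≤ C a) (hb : j ≤ C b) (hc : k ≤ C c) :
    Pi.single a i + Pi.single b j + Pi.single c k ≤ C := by
  intro x
  by_cases hx : x = c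
  · subst hx
    simpa [hac.symm, hbc.symm] using hc
  · simpa [hx] using single_add_single_le hab ha hb x

/-- Two pairs without a common neighbour on a path to `r` still give a pebble on `r` when few
far vertices have an even number of pebbles. -/
lemma exists_reaches_of_pair_of_pair {r v₁ v₂ w₁ w₂ w₃ c₁ c₂ c₃ : V} {N F : Finset V}
    {C : V → ℕ} (hv : v₁ ≠ v₂) (hC₁ : 2 ≤ C v₁) (hC₂ : 2 ≤ C v₂)
    (hN : N ⊆ {w₁, w₂, w₃}) (hw₁ : G.Adj w₁ r) (hw₂ : G.Adj w₂ r) (hw₃ : G.Adj w₃ r)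
    (hr : r ∉ F) (hv₁F : v₁ ∈ F) (hv₂F : v₂ ∈ F) (hc₁F : c₁ ∈ F) (hc₂F : c₂ ∈ F) (hc₃F : c₃ ∈ F)
    (h₁₂ : c₁ ≠ c₂) (h₁₃ : c₁ ≠ c₃) (h₂₃ : c₂ ≠ c₃) (hvw₁ : G.Adj v₁ w₁) (hvw₂ : G.Adj v₂ w₂)
    (hvc₁ : G.Adj v₁ c₁) (hcw₁ : G.Adj c₁ w₂) (hvc₂ : G.Adj v₂ c₂) (hcw₂ : G.Adj c₂ w₁)
    (hvc₃ : G.Adj v₁ c₃) (hcw₃ : G.Adj c₃ w₃) (hv₁w₃ : v₁ ≠ w₃)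
    (hcard : (F.filter fun v => C v % 2 = 0).card ≤ (N.filter fun v => 0 < C v).card + 1) :
    ∃ C', Reaches G C C' ∧ C r < C' r := by
  have hFr : ∀ {v}, v ∈ F → r ≠ v := fun hv h => hr (h ▸ hv)
  have hflip : ∀ {a b c w : V}, a ≠ b → 2 ≤ C a → 2 ≤ C b → a ∈ F → b ∈ F → c ∈ F →
      G.Adj a c → G.Adj c w → G.Adj b w → G.Adj w r → ¬ C c % 2 = 0 →
      ∃ C', Reaches G C C' ∧ C r < C' r := by
    intro a b c w hab ha hb haF hbF hcF hac hcw hbw hwr hodd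
    refine exists_reaches_of_le (X := Pi.single a 2 + Pi.single b 2 + Pi.single c 1) ?_
      (by simp [hFr haF, hFr hbF, hFr hcF]) fun E => ?_
    · by_cases hbc : b = c
      · subst hbc
        rw [add_assoc, ← Pi.single_add]
        exact single_add_single_le hab ha (by omega)
      · exact single_add_single_add_single_le hab hac.ne hbc ha hb (by omega)
    · rw [← add_assoc, ← add_assoc]
      exact reaches_of_flip_of_pair hac hcw hbw hwr E
  have hocc : ∀ {a w : V}, 2 ≤ C a → a ∈ F → G.Adj a w → G.Adj w r → 0 < C w →
      ∃ C', Reaches G C C' ∧ C r < C' r := by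
    intro a w ha haF haw hwr hw
    refine exists_reaches_of_le (X := Pi.single a 2 + Pi.single w 1)
      (single_add_single_le haw.ne ha hw) (by simp [hFr haF, hwr.ne.symm]) fun E => ?_
    rw [← add_assoc]
    exact reaches_of_occupied haw hwr E
  by_cases hpw₁ : 0 < C w₁
  · exact hocc hC₁ hv₁F hvw₁ hw₁ hpw₁
  by_cases hpw₂ : 0 < C w₂
  · exact hocc hC₂ hv₂F hvw₂ hw₂ hpw₂
  by_cases hc₁ : C c₁ % 2 = 0
  swap
  · exact hflip hv hC₁ hC₂ hv₁F hv₂F hc₁F hvc₁ hcw₁ hvw₂ hw₂ hc₁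
  by_cases hc₂ : C c₂ % 2 = 0
  swap
  · exact hflip hv.symm hC₂ hC₁ hv₂F hv₁F hc₂F hvc₂ hcw₂ hvw₁ hw₁ hc₂
  have hsub : N.filter (fun v => 0 < C v) ⊆ ({w₃} : Finset V).filter fun v => 0 < C v := by
    intro w hw
    rw [Finset.mem_filter] at hw
    have := hN hw.1
    simp only [Finset.mem_insert, Finset.mem_singleton] at this
    rcases this with rfl | rfl | rfl
    · exact absurd hw.2 hpw₁
    · exact absurd hw.2 hpw₂
    · simpa using hw.2
  have hle := Finset.card_le_card hsub
  by_cases hpw₃ : 0 < C w₃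
  · by_cases hc₃ : C c₃ % 2 = 0
    · have h3 : ({c₁, c₂, c₃} : Finset V) ⊆ F.filter fun v => C v % 2 = 0 := by
        intro x hx
        simp only [Finset.mem_insert, Finset.mem_singleton] at hx
        rcases hx with rfl | rfl | rfl <;> simp [*]
      have := Finset.card_le_card h3
      rw [Finset.card_eq_three.mpr ⟨c₁, c₂, c₃, h₁₂, h₁₃, h₂₃, rfl⟩] at this
      have := (Finset.card_filter_le ({w₃} : Finset V) fun v => 0 < C v)
      rw [Finset.card_singleton] at this
      omega
    · refine exists_reaches_of_le (X := Pi.single v₁ 2 + Pi.single c₃ 1 + Pi.single w₃ 1)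
        (single_add_single_add_single_le hvc₃.ne hv₁w₃ hcw₃.ne hC₁ (by omega) hpw₃)
        (by simp [hFr hv₁F, hFr hc₃F, hw₃.ne.symm]) fun E => ?_
      rw [← add_assoc, ← add_assoc]
      exact reaches_of_flip hvc₃ hcw₃ hw₃ E
  · have h2 : ({c₁, c₂} : Finset V) ⊆ F.filter fun v => C v % 2 = 0 := by
      intro x hx
      simp only [Finset.mem_insert, Finset.mem_singleton] at hx
      rcases hx with rfl | rfl <;> simp [*]
    have := Finset.card_le_card h2
    rw [Finset.card_pair h₁₂] at this
    rw [Finset.filter_singleton, if_neg hpw₃, Finset.card_empty] at hle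
    omega

end Moves

section Potential

variable {V : Type} [Fintype V] [DecidableEq V] {G : SimpleGraph V}

lemma sum_potential_le_of_step {f : V → ℕ → ℕ}
    (hf : ∀ u v, G.Adj u v → ∀ a b, f u a + f v (b + 1) ≤ f u (a + 2) + f v b)
    {C C' : V → ℕ} (h : PebblingStep G C C') : ∑ v, f v (C' v) ≤ ∑ v, f v (C v) := by
  obtain ⟨u, v, huv, h2, rfl⟩ := h
  have hne := huv.ne
  have hsplit : ∀ g : V → ℕ, ∑ x, g x = g u + (g v + ∑ x ∈ (Finset.univ.erase u).erase v, g x) := by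
    intro g
    rw [Finset.add_sum_erase _ _ (by simp [hne.symm]), Finset.add_sum_erase _ _ (by simp)]
  rw [hsplit, hsplit fun x => f x (C x)]
  have hrest : ∑ x ∈ (Finset.univ.erase u).erase v,
      f x (if x = u then C u - 2 else if x = v then C v + 1 else C x) =
      ∑ x ∈ (Finset.univ.erase u).erase v, f x (C x) := by
    refine Finset.sum_congr rfl fun x hx => ?_
    simp only [Finset.mem_erase] at hx
    simp [hx.1, hx.2.1]
  have := hf u v huv (C u - 2) (C v)
  rw [Nat.sub_add_cancel h2] at this
  simp only [hrest, if_true, hne.symm, if_false]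
  omega

lemma sum_potential_le_of_reaches {f : V → ℕ → ℕ}
    (hf : ∀ u v, G.Adj u v → ∀ a b, f u a + f v (b + 1) ≤ f u (a + 2) + f v b)
    {C C' : V → ℕ} (h : Reaches G C C') : ∑ v, f v (C' v) ≤ ∑ v, f v (C v) := by
  induction h with
  | refl => rfl
  | tail _ h ih => exact (sum_potential_le_of_step hf h).trans ih

lemma exists_le_sum_eq (D : V → ℕ) (M : ℕ) (h : M ≤ ∑ v, D v) :
    ∃ C : V → ℕ, C ≤ D ∧ ∑ v, C v = M := by
  induction M with
  | zero => exact ⟨0, fun _ => Nat.zero_le _, by simp⟩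
  | succ M ih =>
    obtain ⟨C, hCD, hC⟩ := ih (by omega)
    obtain ⟨v, -, hv⟩ := Finset.exists_lt_of_sum_lt (s := Finset.univ) (f := C) (g := D) (by omega)
    refine ⟨C + Pi.single v 1, fun x => ?_, by simp [Finset.sum_add_distrib, hC]⟩
    by_cases hx : x = v
    · subst hx; simpa using hv
    · simpa [hx] using hCD x

/-- If a potential that is nonincreasing along pebbling steps is smaller on `D` than on `t` pebbles
at `r`, then some configuration of every size at most `|D|` is not `t`-fold `r`-solvable. -/
lemma exists_not_solvable {f : V → ℕ → ℕ} (hmono : ∀ v, Monotone (f v))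
    (hf : ∀ u v, G.Adj u v → ∀ a b, f u a + f v (b + 1) ≤ f u (a + 2) + f v b)
    {r : V} {t : ℕ} {D : V → ℕ} (hD : ∑ v, f v (D v) < f r t) {M : ℕ} (hM : M ≤ ∑ v, D v) :
    ∃ C : V → ℕ, ∑ v, C v = M ∧ ¬ Solvable G C (stack r t) := by
  obtain ⟨C, hCD, hC⟩ := exists_le_sum_eq D M hM
  refine ⟨C, hC, fun ⟨C', hreach, ht⟩ => ?_⟩
  have h1 := sum_potential_le_of_reaches hf hreach
  have h2 : ∑ v, f v (C v) ≤ ∑ v, f v (D v) := Finset.sum_le_sum fun v _ => hmono v (hCD v)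
  have h3 : f r (C' r) ≤ ∑ v, f v (C' v) :=
    Finset.single_le_sum (f := fun v => f v (C' v)) (fun _ _ => Nat.zero_le _) (Finset.mem_univ r)
  have h4 : f r t ≤ f r (C' r) := hmono r (by simpa [stack] using ht r)
  omega

end Potential

section Kneser

variable {m : ℕ}

lemma kneserGraph_two_adj {a b : {s : Finset (Fin m) // s.card = 2}} :
    (kneserGraph m 2).Adj a b ↔ Disjoint a.1 b.1 := by
  rw [kneserGraph, SimpleGraph.fromRel_adj, disjoint_comm (a := b.1), or_self]
  refine ⟨And.right, fun h => ⟨?_, h⟩⟩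
  rintro rfl
  have := a.2
  simp [disjoint_self.mp h] at this

/-- The vertex `{a, b}` of `K(m, 2)`. -/
def pairVertex (a b : Fin m) (h : a ≠ b) : {s : Finset (Fin m) // s.card = 2} :=
  ⟨{a, b}, Finset.card_pair h⟩

lemma pairVertex_comm (a b : Fin m) (h : a ≠ b) : pairVertex a b h = pairVertex b a h.symm :=
  Subtype.ext (Finset.pair_comm a b)

lemma adj_pairVertex {a b c d : Fin m} {h : a ≠ b} {h' : c ≠ d} :
    (kneserGraph m 2).Adj (pairVertex a b h) (pairVertex c d h') ↔
      a ≠ c ∧ a ≠ d ∧ b ≠ c ∧ b ≠ d := by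
  rw [kneserGraph_two_adj]
  simp only [pairVertex, Finset.disjoint_insert_left, Finset.disjoint_singleton_left,
    Finset.mem_insert, Finset.mem_singleton]
  tauto

lemma exists_eq_pairVertex {v : {s : Finset (Fin m) // s.card = 2}} {a : Fin m} (h : a ∈ v.1) :
    ∃ b, ∃ hb : a ≠ b, v = pairVertex a b hb := by
  obtain ⟨c, d, hcd, hv⟩ := Finset.card_eq_two.mp v.2
  rw [hv, Finset.mem_insert, Finset.mem_singleton] at h
  rcases h with rfl | rfl
  · exact ⟨d, hcd, Subtype.ext hv⟩
  · exact ⟨c, hcd.symm, Subtype.ext (hv.trans (Finset.pair_comm _ _))⟩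

/-- The neighbours of `r` in `K(m, 2)`. -/
def nearVertices (r : {s : Finset (Fin m) // s.card = 2}) :
    Finset {s : Finset (Fin m) // s.card = 2} :=
  Finset.univ.filter fun v => Disjoint v.1 r.1

/-- The vertices of `K(m, 2)` that are neither `r` nor a neighbour of `r`. -/
def farVertices (r : {s : Finset (Fin m) // s.card = 2}) :
    Finset {s : Finset (Fin m) // s.card = 2} :=
  Finset.univ.filter fun v => v ≠ r ∧ ¬ Disjoint v.1 r.1

lemma mem_nearVertices {r v : {s : Finset (Fin m) // s.card = 2}} :
    v ∈ nearVertices r ↔ (kneserGraph m 2).Adj v r := by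
  simp [nearVertices, kneserGraph_two_adj]

lemma mem_farVertices {r v : {s : Finset (Fin m) // s.card = 2}} :
    v ∈ farVertices r ↔ v ≠ r ∧ ¬ (kneserGraph m 2).Adj v r := by
  simp [farVertices, kneserGraph_two_adj]

lemma exists_eq_pairVertex_of_mem_farVertices {r v : {s : Finset (Fin m) // s.card = 2}}
    (h : v ∈ farVertices r) :
    ∃ p q x, ∃ (hpq : p ≠ q) (hpx : p ≠ x), q ≠ x ∧ r = pairVertex p q hpq ∧
      v = pairVertex p x hpx := by
  rw [mem_farVertices, kneserGraph_two_adj, Finset.not_disjoint_iff] at h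
  obtain ⟨hne, p, hpv, hpr⟩ := h
  obtain ⟨q, hpq, rfl⟩ := exists_eq_pairVertex hpr
  obtain ⟨x, hpx, rfl⟩ := exists_eq_pairVertex hpv
  refine ⟨p, q, x, hpq, hpx, ?_, rfl, rfl⟩
  rintro rfl
  exact hne rfl

lemma pairVertex_mem_farVertices {p q x : Fin m} (hpq : p ≠ q) (hpx : p ≠ x) (hqx : q ≠ x) :
    pairVertex p x hpx ∈ farVertices (pairVertex p q hpq) := by
  rw [mem_farVertices, adj_pairVertex]
  refine ⟨fun h => ?_, by tauto⟩
  have : x ∈ (pairVertex p q hpq).1 := by rw [← h]; simp [pairVertex]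
  simp [pairVertex, hpx.symm, hqx.symm] at this

lemma pairVertex_mem_farVertices' {p q x : Fin m} (hpq : p ≠ q) (hpx : p ≠ x) (hqx : q ≠ x) :
    pairVertex q x hqx ∈ farVertices (pairVertex p q hpq) := by
  rw [pairVertex_comm p q]
  exact pairVertex_mem_farVertices _ _ hpx

lemma exists_eq_pairVertex_of_mem_farVertices_pairVertex {p q : Fin m} {hpq : p ≠ q}
    {v : {s : Finset (Fin m) // s.card = 2}} (h : v ∈ farVertices (pairVertex p q hpq)) :
    ∃ x, ∃ (hpx : p ≠ x) (hqx : q ≠ x), v = pairVertex p x hpx ∨ v = pairVertex q x hqx := by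
  rw [mem_farVertices, kneserGraph_two_adj, Finset.not_disjoint_iff] at h
  obtain ⟨hne, a, hav, har⟩ := h
  obtain ⟨x, hax, rfl⟩ := exists_eq_pairVertex hav
  simp only [pairVertex, Finset.mem_insert, Finset.mem_singleton] at har
  rcases har with rfl | rfl
  · exact ⟨x, hax, fun h => hne (by subst h; rfl), .inl rfl⟩
  · exact ⟨x, fun h => hne (by subst h; exact pairVertex_comm _ _ _), hax, .inr rfl⟩

lemma exists_notMem_of_card_lt {s : Finset (Fin m)} (h : s.card < m) : ∃ z, z ∉ s := by
  by_contra! hall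
  rw [Finset.eq_univ_of_forall hall, Finset.card_univ, Fintype.card_fin] at h
  exact lt_irrefl _ h

lemma exists_common_neighbour {a b c : {s : Finset (Fin m) // s.card = 2}}
    (h : (a.1 ∪ b.1 ∪ c.1).card + 2 ≤ m) :
    ∃ w, (kneserGraph m 2).Adj a w ∧ (kneserGraph m 2).Adj b w ∧ (kneserGraph m 2).Adj w c := by
  have hc : 2 ≤ (a.1 ∪ b.1 ∪ c.1)ᶜ.card := by
    rw [Finset.card_compl, Fintype.card_fin]; omega
  obtain ⟨w, hw, hw2⟩ := Finset.exists_subset_card_eq hc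
  have hd : Disjoint (a.1 ∪ b.1 ∪ c.1) w :=
    Finset.disjoint_left.mpr fun x hx hxw => Finset.mem_compl.mp (hw hxw) hx
  simp only [Finset.disjoint_union_left] at hd
  refine ⟨⟨w, hw2⟩, ?_⟩
  simp only [kneserGraph_two_adj]
  exact ⟨hd.1.1, hd.1.2, hd.2.symm⟩

lemma pairVertex_sdiff {p q x : Fin m} (hpq : p ≠ q) (hpx : p ≠ x) (hqx : q ≠ x) :
    (pairVertex p x hpx).1 \ (pairVertex p q hpq).1 = {x} := by
  ext y
  simp only [pairVertex, Finset.mem_sdiff, Finset.mem_insert, Finset.mem_singleton]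
  constructor
  · tauto
  · rintro rfl
    simp [hpx.symm, hqx.symm]

lemma pairVertex_sdiff' {p q x : Fin m} (hpq : p ≠ q) (hpx : p ≠ x) (hqx : q ≠ x) :
    (pairVertex q x hqx).1 \ (pairVertex p q hpq).1 = {x} := by
  rw [pairVertex_comm p q]
  exact pairVertex_sdiff _ _ hpx

lemma card_sdiff_of_mem_farVertices {r v : {s : Finset (Fin m) // s.card = 2}}
    (h : v ∈ farVertices r) : (v.1 \ r.1).card = 1 := by
  obtain ⟨p, q, x, hpq, hpx, hqx, rfl, rfl⟩ := exists_eq_pairVertex_of_mem_farVertices h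
  rw [pairVertex_sdiff hpq hpx hqx, Finset.card_singleton]

lemma union_eq_sdiff_union {r a b : Finset (Fin m)} : a ∪ b ∪ r = (a \ r ∪ b \ r) ∪ r := by
  ext; simp; tauto

lemma exists_common_neighbour_of_sdiff_eq (hm : 5 ≤ m)
    {r v v' : {s : Finset (Fin m) // s.card = 2}} (hv : v ∈ farVertices r)
    (h : v.1 \ r.1 = v'.1 \ r.1) :
    ∃ w, (kneserGraph m 2).Adj v w ∧ (kneserGraph m 2).Adj v' w ∧ (kneserGraph m 2).Adj w r := by
  apply exists_common_neighbour
  have h1 := card_sdiff_of_mem_farVertices hv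
  have h2 := r.2
  rw [union_eq_sdiff_union, ← h, Finset.union_self]
  have := Finset.card_union_le (v.1 \ r.1) r.1
  omega

lemma exists_common_neighbour_of_six_le (hm : 6 ≤ m)
    {r v v' : {s : Finset (Fin m) // s.card = 2}} (hv : v ∈ farVertices r)
    (hv' : v' ∈ farVertices r) :
    ∃ w, (kneserGraph m 2).Adj v w ∧ (kneserGraph m 2).Adj v' w ∧ (kneserGraph m 2).Adj w r := by
  apply exists_common_neighbour
  have h1 := card_sdiff_of_mem_farVertices hv
  have h1' := card_sdiff_of_mem_farVertices hv'
  have h2 := r.2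
  rw [union_eq_sdiff_union]
  have := Finset.card_union_le (v.1 \ r.1 ∪ v'.1 \ r.1) r.1
  have := Finset.card_union_le (v.1 \ r.1) (v'.1 \ r.1)
  omega

/-- If no vertex of `W ⊆ N(r)` is adjacent to the far vertex `v`, then at least `|W|` far
neighbours of `v` have a neighbour in `W`. -/
lemma exists_far_neighbours (hm : 5 ≤ m) {r v : {s : Finset (Fin m) // s.card = 2}}
    (hv : v ∈ farVertices r) {W : Finset {s : Finset (Fin m) // s.card = 2}}
    (hW : W ⊆ nearVertices r) (hadj : ∀ w ∈ W, ¬ (kneserGraph m 2).Adj v w) :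
    ∃ U ⊆ farVertices r, W.card ≤ U.card ∧
      ∀ u ∈ U, (kneserGraph m 2).Adj v u ∧ ∃ w ∈ W, (kneserGraph m 2).Adj u w := by
  classical
  obtain ⟨p, q, x, hpq, hpx, hqx, rfl, rfl⟩ := exists_eq_pairVertex_of_mem_farVertices hv
  have hrep : ∀ w ∈ W, ∃ y, ∃ hxy : x ≠ y, p ≠ y ∧ q ≠ y ∧ w = pairVertex x y hxy := by
    intro w hw
    have h1 := mem_nearVertices.mp (hW hw)
    have h2 := hadj w hw
    rw [kneserGraph_two_adj] at h1 h2
    have hxw : x ∈ w.1 := by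
      simp only [pairVertex, Finset.disjoint_insert_right, Finset.disjoint_insert_left,
        Finset.disjoint_singleton_right, Finset.disjoint_singleton_left] at h1 h2
      tauto
    obtain ⟨y, hxy, rfl⟩ := exists_eq_pairVertex hxw
    rw [← kneserGraph_two_adj, adj_pairVertex] at h1
    exact ⟨y, hxy, h1.2.2.1.symm, h1.2.2.2.symm, rfl⟩
  rcases lt_or_ge 1 W.card with hcard | hcard
  · refine ⟨(farVertices (pairVertex p q hpq)).filter fun u =>
      (kneserGraph m 2).Adj (pairVertex p x hpx) u ∧ ∃ w ∈ W, (kneserGraph m 2).Adj u w,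
      Finset.filter_subset _ _, ?_, fun u hu => (Finset.mem_filter.mp hu).2⟩
    refine Finset.card_le_card_of_forall_subsingleton
      (fun w u => ∃ y, ∃ (hxy : x ≠ y) (hqy : q ≠ y), w = pairVertex x y hxy ∧
        u = pairVertex q y hqy) ?_ ?_
    · intro w hw
      obtain ⟨w', hw', hne⟩ := Finset.exists_mem_ne hcard w
      obtain ⟨y, hxy, hpy, hqy, rfl⟩ := hrep w hw
      obtain ⟨y', hxy', hpy', hqy', rfl⟩ := hrep w' hw'
      refine ⟨pairVertex q y hqy, ?_, y, hxy, hqy, rfl, rfl⟩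
      rw [Finset.mem_filter, adj_pairVertex]
      refine ⟨pairVertex_mem_farVertices' hpq hpy hqy, ⟨hpq, hpy, hqx.symm, hxy⟩, _, hw', ?_⟩
      rw [adj_pairVertex]
      refine ⟨hqx, hqy', hxy.symm, ?_⟩
      rintro rfl
      exact hne rfl
    · rintro u - w ⟨-, y, hxy, hqy, rfl, rfl⟩ w' ⟨-, y', hxy', hqy', rfl, hu⟩
      have : y ∈ (pairVertex q y' hqy').1 := by rw [← hu]; simp [pairVertex]
      simp only [pairVertex, Finset.mem_insert, Finset.mem_singleton, hqy.symm, false_or] at this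
      subst this
      rfl
  · rcases W.eq_empty_or_nonempty with rfl | ⟨w, hw⟩
    · exact ⟨∅, by simp⟩
    obtain ⟨y, hxy, hpy, hqy, rfl⟩ := hrep w hw
    obtain ⟨z, hz⟩ : ∃ z, z ∉ ({p, q, x, y} : Finset (Fin m)) :=
      exists_notMem_of_card_lt (lt_of_le_of_lt Finset.card_le_four (by omega))
    simp only [Finset.mem_insert, Finset.mem_singleton, not_or] at hz
    obtain ⟨hzp, hzq, hzx, hzy⟩ := hz
    refine ⟨{pairVertex q z (Ne.symm hzq)}, ?_, by simpa using hcard, ?_⟩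
    · rw [Finset.singleton_subset_iff]
      exact pairVertex_mem_farVertices' hpq (Ne.symm hzp) _
    · intro u hu
      rw [Finset.mem_singleton.mp hu]
      refine ⟨adj_pairVertex.mpr ⟨hpq, Ne.symm hzp, hqx.symm, Ne.symm hzx⟩, _, hw,
        adj_pairVertex.mpr ⟨hqx, hqy, hzx, hzy⟩⟩

lemma exists_reaches_of_three_pairs {p q x y z : Fin m} (hpq : p ≠ q) (hpx : p ≠ x) (hqx : q ≠ x)
    (hpy : p ≠ y) (hqy : q ≠ y) (hpz : p ≠ z) (hqz : q ≠ z) (hxy : x ≠ y) (hxz : x ≠ z)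
    (hyz : y ≠ z) {v : {s : Finset (Fin m) // s.card = 2}}
    (hv : v = pairVertex p z hpz ∨ v = pairVertex q z hqz)
    {C : {s : Finset (Fin m) // s.card = 2} → ℕ} (hCx : 2 ≤ C (pairVertex p x hpx))
    (hCy : 2 ≤ C (pairVertex p y hpy)) (hCv : 2 ≤ C v) :
    ∃ C', Reaches (kneserGraph m 2) C C' ∧ C (pairVertex p q hpq) < C' (pairVertex p q hpq) := by
  have hmem : z ∈ v.1 := by rcases hv with rfl | rfl <;> simp [pairVertex]
  have hne : ∀ {a b} {h : a ≠ b}, z ≠ a → z ≠ b → pairVertex a b h ≠ v := by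
    rintro a b h ha hb rfl
    simp [pairVertex, ha, hb] at hmem
  have hpxy : pairVertex p x hpx ≠ pairVertex p y hpy := by
    intro h
    have : x ∈ (pairVertex p y hpy).1 := by rw [← h]; simp [pairVertex]
    simp [pairVertex, hpx.symm, hxy] at this
  have hr : ∀ {a} {h : p ≠ a}, q ≠ a → pairVertex p q hpq ≠ pairVertex p a h := by
    intro a h ha heq
    have : q ∈ (pairVertex p a h).1 := by rw [← heq]; simp [pairVertex]
    simp [pairVertex, hpq.symm, ha] at this
  refine exists_reaches_of_le
    (X := Pi.single (pairVertex p x hpx) 2 + Pi.single v 2 + Pi.single (pairVertex p y hpy) 2)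
    (single_add_single_add_single_le (hne hpz.symm hxz.symm) hpxy (hne hpz.symm hyz.symm).symm
      hCx hCv hCy)
    (by simp [hr hqx, hr hqy, hne (h := hpq) hpz.symm hqz.symm]) fun E => ?_
  rw [← add_assoc, ← add_assoc]
  refine reaches_of_three_pairs (u := pairVertex q z hqz) (w := pairVertex x y hxy)
    ?_ ?_ ?_ ?_ ?_ E
  · exact adj_pairVertex.mpr ⟨hpq, hpz, hqx.symm, hxz⟩
  · exact adj_pairVertex.mpr ⟨hpq, hpz, hqy.symm, hyz⟩
  · exact adj_pairVertex.mpr ⟨hqx, hqy, hxz.symm, hyz.symm⟩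
  · rcases hv with rfl | rfl
    · exact adj_pairVertex.mpr ⟨hpx, hpy, hxz.symm, hyz.symm⟩
    · exact adj_pairVertex.mpr ⟨hqx, hqy, hxz.symm, hyz.symm⟩
  · exact adj_pairVertex.mpr ⟨hpx.symm, hqx.symm, hpy.symm, hqy.symm⟩

lemma notMem_farVertices_self {r : {s : Finset (Fin m) // s.card = 2}} : r ∉ farVertices r := by
  simp [mem_farVertices]

lemma notMem_nearVertices_self {r : {s : Finset (Fin m) // s.card = 2}} : r ∉ nearVertices r := by
  simp [mem_nearVertices]

lemma disjoint_farVertices_nearVertices {r v : {s : Finset (Fin m) // s.card = 2}}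
    (h : v ∈ farVertices r) : v ∉ nearVertices r := by
  rw [mem_nearVertices]
  exact (mem_farVertices.mp h).2

lemma exists_reaches_of_two_pairs {r v₁ v₂ : {s : Finset (Fin 5) // s.card = 2}}
    (hv₁ : v₁ ∈ farVertices r) (hv₂ : v₂ ∈ farVertices r) (hne : v₁.1 \ r.1 ≠ v₂.1 \ r.1)
    {C : {s : Finset (Fin 5) // s.card = 2} → ℕ} (hC₁ : 2 ≤ C v₁) (hC₂ : 2 ≤ C v₂)
    (hcard : ((farVertices r).filter fun v => C v % 2 = 0).card ≤
      ((nearVertices r).filter fun v => 0 < C v).card + 1) :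
    ∃ C', Reaches (kneserGraph 5 2) C C' ∧ C r < C' r := by
  obtain ⟨p, q, x, hpq, hpx, hqx, rfl, rfl⟩ := exists_eq_pairVertex_of_mem_farVertices hv₁
  obtain ⟨y, hpy, hqy, hv₂'⟩ := exists_eq_pairVertex_of_mem_farVertices_pairVertex hv₂
  have hxy : x ≠ y := by
    rintro rfl
    apply hne
    rcases hv₂' with rfl | rfl
    · rfl
    · rw [pairVertex_sdiff hpq hpx hqx, pairVertex_sdiff' hpq hpx hqx]
  obtain ⟨z, hz⟩ : ∃ z, z ∉ ({p, q, x, y} : Finset (Fin 5)) :=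
    exists_notMem_of_card_lt (lt_of_le_of_lt Finset.card_le_four (by omega))
  simp only [Finset.mem_insert, Finset.mem_singleton, not_or] at hz
  obtain ⟨hpz, hqz, hxz, hyz⟩ : p ≠ z ∧ q ≠ z ∧ x ≠ z ∧ y ≠ z :=
    ⟨Ne.symm hz.1, Ne.symm hz.2.1, Ne.symm hz.2.2.1, Ne.symm hz.2.2.2⟩
  have huniv : ∀ a, a = p ∨ a = q ∨ a = x ∨ a = y ∨ a = z := by
    have : ({p, q, x, y, z} : Finset (Fin 5)) = Finset.univ := by
      rw [← Finset.card_eq_iff_eq_univ, Fintype.card_fin]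
      simp [hpq, hpx, hpy, hqx, hqy, hxy, hpz, hqz, hxz, hyz]
    intro a
    have ha := Finset.mem_univ a
    rw [← this] at ha
    simpa using ha
  have hnear : nearVertices (pairVertex p q hpq) ⊆
      {pairVertex y z hyz, pairVertex x z hxz, pairVertex x y hxy} := by
    intro w hw
    obtain ⟨a, b, hab, hw'⟩ := Finset.card_eq_two.mp w.2
    obtain rfl : w = pairVertex a b hab := Subtype.ext hw'
    rw [mem_nearVertices, adj_pairVertex] at hw
    obtain ⟨hap, haq, hbp, hbq⟩ := hw
    simp only [Finset.mem_insert, Finset.mem_singleton]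
    have ha := huniv a
    have hb := huniv b
    simp only [hap, haq, hbp, hbq, false_or] at ha hb
    rcases ha with rfl | rfl | rfl <;> rcases hb with rfl | rfl | rfl <;>
      first
      | exact absurd rfl hab
      | exact .inl rfl
      | exact .inr (.inl rfl)
      | exact .inr (.inr rfl)
      | exact .inl (pairVertex_comm _ _ _)
      | exact .inr (.inl (pairVertex_comm _ _ _))
      | exact .inr (.inr (pairVertex_comm _ _ _))
  have hclass : ∀ {a b c d : Fin 5} {h : a ≠ b} {h' : c ≠ d}, b ≠ c → b ≠ d →
      pairVertex a b h ≠ pairVertex c d h' := by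
    intro a b c d h h' hc hd heq
    have : b ∈ (pairVertex c d h').1 := by rw [← heq]; simp [pairVertex]
    simp [pairVertex, hc, hd] at this
  have hv : pairVertex p x hpx ≠ v₂ := by rintro rfl; exact hne rfl
  rcases hv₂' with rfl | rfl
  · refine exists_reaches_of_pair_of_pair (c₁ := pairVertex q y hqy) (c₂ := pairVertex q x hqx)
      (c₃ := pairVertex q z hqz) hv hC₁ hC₂ hnear ?_ ?_ ?_ notMem_farVertices_self hv₁ hv₂
      (pairVertex_mem_farVertices' _ hpy _) (pairVertex_mem_farVertices' _ hpx _)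
      (pairVertex_mem_farVertices' _ hpz _) (hclass hqy.symm hxy.symm)
      (hclass hqy.symm hyz) (hclass hqx.symm hxz) ?_ ?_ ?_ ?_ ?_ ?_ ?_ ?_ ?_
      hcard
    all_goals first
      | (rw [adj_pairVertex]; refine ⟨?_, ?_, ?_, ?_⟩)
      | (rw [pairVertex_comm]; apply hclass)
    all_goals first | assumption | (apply Ne.symm; assumption)
  · refine exists_reaches_of_pair_of_pair (c₁ := pairVertex q y hqy) (c₂ := pairVertex p x hpx)
      (c₃ := pairVertex q z hqz) hv hC₁ hC₂ hnear ?_ ?_ ?_ notMem_farVertices_self hv₁ hv₂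
      hv₂ hv₁
      (pairVertex_mem_farVertices' _ hpz _) (hclass hpy.symm hxy.symm)
      (hclass hqy.symm hyz) (hclass hqx.symm hxz) ?_ ?_ ?_ ?_ ?_ ?_ ?_ ?_ ?_
      hcard
    all_goals first
      | (rw [adj_pairVertex]; refine ⟨?_, ?_, ?_, ?_⟩)
      | (rw [pairVertex_comm]; apply hclass)
    all_goals first | assumption | (apply Ne.symm; assumption)

/-- In the absence of a four-pebble solution through a common neighbour, at most three pairs lie
on the far vertices, and a single pebble can still be brought to `r`. -/
lemma exists_reaches_of_no_common_neighbour (hm : 5 ≤ m)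
    {r : {s : Finset (Fin m) // s.card = 2}} {C : {s : Finset (Fin m) // s.card = 2} → ℕ}
    (hno : ∀ v ∈ farVertices r, ∀ v' ∈ farVertices r, Pi.single v 2 + Pi.single v' 2 ≤ C →
      ∀ w, (kneserGraph m 2).Adj v w → (kneserGraph m 2).Adj v' w → ¬ (kneserGraph m 2).Adj w r)
    (hP : 2 ≤ ∑ v ∈ farVertices r, C v / 2)
    (hcard : 4 + ((farVertices r).filter fun v => C v % 2 = 0).card ≤
      2 * ∑ v ∈ farVertices r, C v / 2 + ((nearVertices r).filter fun v => 0 < C v).card + 1) :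
    ∑ v ∈ farVertices r, C v / 2 ≤ 3 ∧ ∃ C', Reaches (kneserGraph m 2) C C' ∧ C r < C' r := by
  have hC3 : ∀ v ∈ farVertices r, C v ≤ 3 := by
    intro v hv
    by_contra! h
    obtain ⟨w, h1, h2, h3⟩ := exists_common_neighbour_of_sdiff_eq hm hv (v' := v) rfl
    refine hno v hv v hv ?_ w h1 h2 h3
    rw [← Pi.single_add]
    intro x
    by_cases hx : x = v
    · subst hx; rw [Pi.single_eq_same]; exact h
    · simp [hx]
  obtain ⟨Q, hQ⟩ : ∃ Q, Q = (farVertices r).filter fun v => 2 ≤ C v := ⟨_, rfl⟩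
  have hQmem : ∀ {v}, v ∈ Q → v ∈ farVertices r ∧ 2 ≤ C v := fun h => by
    rwa [hQ, Finset.mem_filter] at h
  have hPQ : ∑ v ∈ farVertices r, C v / 2 = Q.card := by
    rw [hQ, Finset.card_filter]
    refine Finset.sum_congr rfl fun v hv => ?_
    have := hC3 v hv
    split_ifs <;> omega
  have hinj : ∀ v ∈ Q, ∀ v' ∈ Q, v.1 \ r.1 = v'.1 \ r.1 → v = v' := by
    intro v hv v' hv' h
    by_contra hne
    obtain ⟨w, h1, h2, h3⟩ := exists_common_neighbour_of_sdiff_eq hm (hQmem hv).1 h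
    exact hno v (hQmem hv).1 v' (hQmem hv').1
      (single_add_single_le hne (hQmem hv).2 (hQmem hv').2) w h1 h2 h3
  obtain rfl : m = 5 := by
    by_contra hm5
    obtain ⟨v, hv, v', hv', hne⟩ := Finset.one_lt_card.mp (hPQ ▸ hP)
    obtain ⟨w, h1, h2, h3⟩ := exists_common_neighbour_of_six_le (by omega) (hQmem hv).1 (hQmem hv').1
    exact hno v (hQmem hv).1 v' (hQmem hv').1
      (single_add_single_le hne (hQmem hv).2 (hQmem hv').2) w h1 h2 h3
  have hQ3 : Q.card ≤ 3 := by
    have h := Finset.card_le_card_of_injOn (s := Q) (t := Finset.powersetCard 1 r.1ᶜ)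
      (fun v => v.1 \ r.1) ?_ fun v hv v' hv' h => hinj v hv v' hv' h
    · simpa [Finset.card_compl, r.2] using h
    · intro v hv
      rw [Finset.mem_coe, Finset.mem_powersetCard]
      refine ⟨fun x hx => ?_, card_sdiff_of_mem_farVertices (hQmem hv).1⟩
      simpa using (Finset.mem_sdiff.mp hx).2
  refine ⟨hPQ ▸ hQ3, ?_⟩
  rw [hPQ] at hP hcard
  rcases (by omega : Q.card = 2 ∨ Q.card = 3) with h2 | h3
  · obtain ⟨v, hv, v', hv', hne⟩ := Finset.one_lt_card.mp hP
    exact exists_reaches_of_two_pairs (hQmem hv).1 (hQmem hv').1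
      (fun h => hne (hinj v hv v' hv' h)) (hQmem hv).2 (hQmem hv').2 (by omega)
  · obtain ⟨v₁, v₂, v₃, h₁₂, h₁₃, h₂₃, hQe⟩ := Finset.card_eq_three.mp h3
    have hv₁ : v₁ ∈ Q := by simp [hQe]
    have hv₂ : v₂ ∈ Q := by simp [hQe]
    have hv₃ : v₃ ∈ Q := by simp [hQe]
    have hC₁ := (hQmem hv₁).2
    have hC₂ := (hQmem hv₂).2
    have hC₃ := (hQmem hv₃).2
    obtain ⟨p, q, x, hpq, hpx, hqx, rfl, rfl⟩ :=
      exists_eq_pairVertex_of_mem_farVertices (hQmem hv₁).1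
    obtain ⟨y, hpy, hqy, hy⟩ :=
      exists_eq_pairVertex_of_mem_farVertices_pairVertex (hQmem hv₂).1
    obtain ⟨z, hpz, hqz, hz⟩ :=
      exists_eq_pairVertex_of_mem_farVertices_pairVertex (hQmem hv₃).1
    have hsd : ∀ {v a}, ∀ (hpa : p ≠ a) (hqa : q ≠ a),
        v = pairVertex p a hpa ∨ v = pairVertex q a hqa → v.1 \ (pairVertex p q hpq).1 = {a} := by
      rintro v a hpa hqa (rfl | rfl)
      · exact pairVertex_sdiff hpq hpa hqa
      · exact pairVertex_sdiff' hpq hpa hqa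
    have hx := hsd hpx hqx (.inl rfl)
    have hy' := hsd hpy hqy hy
    have hz' := hsd hpz hqz hz
    have hxy : x ≠ y := by
      rintro rfl; exact h₁₂ (hinj _ hv₁ _ hv₂ (hx.trans hy'.symm))
    have hxz : x ≠ z := by
      rintro rfl; exact h₁₃ (hinj _ hv₁ _ hv₃ (hx.trans hz'.symm))
    have hyz : y ≠ z := by
      rintro rfl; exact h₂₃ (hinj _ hv₂ _ hv₃ (hy'.trans hz'.symm))
    rcases hy with rfl | rfl
    · exact exists_reaches_of_three_pairs hpq hpx hqx hpy hqy hpz hqz hxy hxz hyz hz hC₁ hC₂ hC₃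
    · rcases hz with rfl | rfl
      · exact exists_reaches_of_three_pairs hpq hpx hqx hpz hqz hpy hqy hxz hxy hyz.symm (.inr rfl)
          hC₁ hC₃ hC₂
      · rw [pairVertex_comm p q]
        exact exists_reaches_of_three_pairs hpq.symm hqy hpy hqz hpz hqx hpx hyz hxy.symm hxz.symm
          (.inr rfl) hC₂ hC₃ hC₁

lemma sum_add_single_of_notMem {V : Type} [DecidableEq V] {s : Finset V} {v : V} (hv : v ∉ s)
    (f : ℕ → ℕ) (E : V → ℕ) (n : ℕ) :
    ∑ x ∈ s, f ((E + Pi.single v n : V → ℕ) x) = ∑ x ∈ s, f (E x) :=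
  Finset.sum_congr rfl fun x hx => by
    have : x ≠ v := fun h => hv (h ▸ hx)
    simp [this]

lemma sum_add_single_of_mem {V : Type} [DecidableEq V] {s : Finset V} {v : V} (hv : v ∈ s)
    (E : V → ℕ) (n : ℕ) :
    ∑ x ∈ s, (E + Pi.single v n : V → ℕ) x = ∑ x ∈ s, E x + n := by
  simp only [Pi.add_apply, Finset.sum_add_distrib]
  simp [hv]

lemma sum_half_add_single_two {V : Type} [DecidableEq V] {s : Finset V} {v : V} (hv : v ∈ s)
    (E : V → ℕ) :
    ∑ x ∈ s, (E + Pi.single v 2 : V → ℕ) x / 2 = ∑ x ∈ s, E x / 2 + 1 := by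
  rw [← sum_add_single_of_mem hv (fun x => E x / 2) 1]
  refine Finset.sum_congr rfl fun x _ => ?_
  by_cases hx : x = v
  · subst hx; simp
  · simp [hx]

lemma card_filter_add_single_of_notMem {V : Type} [DecidableEq V] {s : Finset V} {v : V}
    (hv : v ∉ s) (E : V → ℕ) (n : ℕ) :
    (s.filter fun x => 0 < (E + Pi.single v n : V → ℕ) x).card =
      (s.filter fun x => 0 < E x).card := by
  congr 1
  refine Finset.filter_congr fun x hx => ?_
  have : x ≠ v := fun h => hv (h ▸ hx)
  simp [this]

lemma card_filter_add_single_le {V : Type} [DecidableEq V] (s : Finset V) (v : V)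
    (E : V → ℕ) (n : ℕ) :
    (s.filter fun x => 0 < (E + Pi.single v n : V → ℕ) x).card ≤
      (s.filter fun x => 0 < E x).card + 1 := by
  refine (Finset.card_le_card (t := insert v (s.filter fun x => 0 < E x)) fun x hx => ?_).trans
    (Finset.card_insert_le _ _)
  by_cases hxv : x = v
  · simp [hxv]
  · simpa [hxv] using hx

lemma sum_eq_pairs_add_card {V : Type} (s : Finset V) (C : V → ℕ) :
    ∑ v ∈ s, C v + (s.filter fun v => C v % 2 = 0).card = 2 * ∑ v ∈ s, C v / 2 + s.card := by
  rw [Finset.card_filter, Finset.card_eq_sum_ones, Finset.mul_sum, ← Finset.sum_add_distrib,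
    ← Finset.sum_add_distrib]
  refine Finset.sum_congr rfl fun v _ => ?_
  split_ifs <;> omega

/-- Enough pebbles on the far vertices, together with occupied neighbours of `r`, yield `t`
further pebbles on `r`. -/
lemma exists_reaches_of_far_pebbles (hm : 5 ≤ m) (r : {s : Finset (Fin m) // s.card = 2}) (t : ℕ) :
    ∀ C : {s : Finset (Fin m) // s.card = 2} → ℕ,
      4 * t + (farVertices r).card ≤
        ∑ v ∈ farVertices r, C v + ((nearVertices r).filter fun v => 0 < C v).card + 1 →
      t ≤ ∑ v ∈ farVertices r, C v / 2 →
      ∃ C', Reaches (kneserGraph m 2) C C' ∧ C r + t ≤ C' r := by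
  induction t with
  | zero => exact fun C _ _ => ⟨C, .refl, le_rfl⟩
  | succ t ih =>
    intro C hS hP
    have hrF := notMem_farVertices_self (r := r)
    have hrN := notMem_nearVertices_self (r := r)
    have hFN : ∀ {v}, v ∈ farVertices r → v ∉ nearVertices r := disjoint_farVertices_nearVertices
    have hNF : ∀ {v}, v ∈ nearVertices r → v ∉ farVertices r := fun h h' => hFN h' h
    have hFr : ∀ {v}, v ∈ farVertices r → r ≠ v := fun h h' => hrF (h' ▸ h)
    have hNr : ∀ {v}, v ∈ nearVertices r → r ≠ v := fun h h' => hrN (h' ▸ h)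
    have hpairs := sum_eq_pairs_add_card (farVertices r) C
    have hgain : ∀ X : {s : Finset (Fin m) // s.card = 2} → ℕ, X ≤ C → X r = 0 →
        (∀ E, Reaches (kneserGraph m 2) (E + X) (E + Pi.single r 1)) →
        (∀ E, C = E + X →
          4 * t + (farVertices r).card ≤
            ∑ v ∈ farVertices r, E v + ((nearVertices r).filter fun v => 0 < E v).card + 1 ∧
          t ≤ ∑ v ∈ farVertices r, E v / 2) →
        ∃ C', Reaches (kneserGraph m 2) C C' ∧ C r + (t + 1) ≤ C' r := by
      intro X hle hXr hreach hstat
      obtain ⟨E, rfl⟩ : ∃ E, C = E + X := ⟨C - X, (tsub_add_cancel_of_le hle).symm⟩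
      obtain ⟨h1, h2⟩ := hstat E rfl
      obtain ⟨C', hC', hr⟩ := ih (E + Pi.single r 1)
        (by rwa [sum_add_single_of_notMem hrF fun x => x, card_filter_add_single_of_notMem hrN])
        (by rwa [sum_add_single_of_notMem hrF (· / 2)])
      refine ⟨C', (hreach E).trans hC', ?_⟩
      simp only [Pi.add_apply, Pi.single_eq_same, hXr] at hr ⊢
      omega
    by_cases hk : ((farVertices r).filter fun v => C v % 2 = 0).card <
        ((nearVertices r).filter fun v => 0 < C v).card
    · obtain ⟨v, hvF, hv⟩ : ∃ v ∈ farVertices r, 2 ≤ C v := by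
        by_contra! h
        rw [Finset.sum_eq_zero fun v hv => Nat.div_eq_of_lt (h v hv)] at hP
        omega
      by_cases hadj : ∃ w ∈ (nearVertices r).filter fun v => 0 < C v, (kneserGraph m 2).Adj v w
      · obtain ⟨w, hw, hvw⟩ := hadj
        rw [Finset.mem_filter] at hw
        refine hgain (Pi.single v 2 + Pi.single w 1) (single_add_single_le hvw.ne hv hw.2)
          (by simp [hFr hvF, hNr hw.1])
          (fun E => by
            rw [← add_assoc]
            exact reaches_of_occupied hvw (mem_nearVertices.mp hw.1) E) ?_
        rintro E rfl
        rw [← add_assoc] at hS hP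
        rw [sum_add_single_of_notMem (hNF hw.1) fun x => x] at hS
        rw [sum_add_single_of_notMem (hNF hw.1) (· / 2), sum_half_add_single_two hvF] at hP
        have h1 := card_filter_add_single_le (nearVertices r) w (E + Pi.single v 2) 1
        rw [card_filter_add_single_of_notMem (hFN hvF)] at h1
        have h2 := sum_add_single_of_mem hvF E 2
        omega
      · push Not at hadj
        obtain ⟨U, hUF, hcard, hU⟩ := exists_far_neighbours hm hvF (Finset.filter_subset _ _) hadj
        obtain ⟨u, huU, hu⟩ := Finset.exists_mem_notMem_of_card_lt_card (hk.trans_le hcard)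
        obtain ⟨hvu, w, hw, huw⟩ := hU u huU
        have huF := hUF huU
        rw [Finset.mem_filter] at hw
        have hodd : C u % 2 ≠ 0 := fun h => hu (Finset.mem_filter.mpr ⟨huF, h⟩)
        have hvw : v ≠ w := fun h => hNF hw.1 (h ▸ hvF)
        refine hgain (Pi.single v 2 + Pi.single u 1 + Pi.single w 1)
          (single_add_single_add_single_le hvu.ne hvw huw.ne hv (by omega) hw.2)
          (by simp [hFr hvF, hFr huF, hNr hw.1])
          (fun E => by
            rw [← add_assoc, ← add_assoc]
            exact reaches_of_flip hvu huw (mem_nearVertices.mp hw.1) E) ?_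
        rintro E rfl
        have hE : ∑ x ∈ farVertices r, (E + Pi.single u 1 : _ → ℕ) x / 2 =
            ∑ x ∈ farVertices r, E x / 2 := by
          refine Finset.sum_congr rfl fun x _ => ?_
          by_cases hx : x = u
          · subst hx
            simp only [Pi.add_apply, Pi.single_eq_same, Pi.single_eq_of_ne hvu.ne.symm,
              Pi.single_eq_of_ne huw.ne] at hodd ⊢
            omega
          · simp [hx]
        rw [← add_assoc, ← add_assoc] at hS hP
        rw [sum_add_single_of_notMem (hNF hw.1) fun x => x] at hS
        rw [sum_add_single_of_notMem (hNF hw.1) (· / 2), add_right_comm,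
          sum_half_add_single_two hvF, hE] at hP
        have h1 := card_filter_add_single_le (nearVertices r) w
          (E + Pi.single v 2 + Pi.single u 1) 1
        rw [card_filter_add_single_of_notMem (hFN huF),
          card_filter_add_single_of_notMem (hFN hvF)] at h1
        have h2 := sum_add_single_of_mem hvF E 2
        have h3 := sum_add_single_of_mem huF (E + Pi.single v 2) 1
        omega
    · by_cases hno : ∀ v ∈ farVertices r, ∀ v' ∈ farVertices r, Pi.single v 2 + Pi.single v' 2 ≤ C →
          ∀ w, (kneserGraph m 2).Adj v w → (kneserGraph m 2).Adj v' w → ¬ (kneserGraph m 2).Adj w r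
      · obtain ⟨h3, C', hC', hr⟩ := exists_reaches_of_no_common_neighbour hm hno (by omega) (by omega)
        exact ⟨C', hC', by omega⟩
      · push Not at hno
        obtain ⟨v, hvF, v', hvF', hle, w, hvw, hvw', hwr⟩ := hno
        refine hgain _ hle (by simp [hFr hvF, hFr hvF'])
          (fun E => by
            rw [← add_assoc]
            exact reaches_of_two_pairs hvw hvw' hwr E) ?_
        rintro E rfl
        have hP' : 2 * (t + 1) ≤
          ∑ x ∈ farVertices r, (E + (Pi.single v 2 + Pi.single v' 2) : _ → ℕ) x / 2 := by omega
        rw [← add_assoc] at hS hP'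
        rw [sum_half_add_single_two hvF', sum_half_add_single_two hvF] at hP'
        rw [sum_add_single_of_mem hvF', sum_add_single_of_mem hvF,
          card_filter_add_single_of_notMem (hFN hvF'),
          card_filter_add_single_of_notMem (hFN hvF)] at hS
        omega

lemma sum_eq_root_add_near_add_far (r : {s : Finset (Fin m) // s.card = 2})
    (C : {s : Finset (Fin m) // s.card = 2} → ℕ) :
    ∑ v, C v = C r + ∑ v ∈ nearVertices r, C v + ∑ v ∈ farVertices r, C v := by
  have hU : (Finset.univ : Finset {s : Finset (Fin m) // s.card = 2}) =
      insert r (nearVertices r ∪ farVertices r) := by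
    ext v
    simp only [Finset.mem_univ, Finset.mem_insert, Finset.mem_union, mem_nearVertices,
      mem_farVertices, true_iff]
    tauto
  rw [hU, Finset.sum_insert, Finset.sum_union, add_assoc]
  · exact Finset.disjoint_right.mpr fun v hv => disjoint_farVertices_nearVertices hv
  · simp [notMem_farVertices_self, notMem_nearVertices_self]

lemma card_kneser_vertices : Fintype.card {s : Finset (Fin m) // s.card = 2} = m.choose 2 := by
  rw [Fintype.card_finset_len, Fintype.card_fin]

lemma card_nearVertices (r : {s : Finset (Fin m) // s.card = 2}) :
    (nearVertices r).card = (m - 2).choose 2 := by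
  have h : (nearVertices r).map (Function.Embedding.subtype _) = Finset.powersetCard 2 r.1ᶜ := by
    ext s
    simp only [nearVertices, Finset.mem_map, Finset.mem_filter, Finset.mem_univ, true_and,
      Function.Embedding.subtype_apply, Finset.mem_powersetCard, Subtype.exists, exists_and_right,
      exists_eq_right, Finset.subset_compl_iff_disjoint_right]
    tauto
  rw [← Finset.card_map, h, Finset.card_powersetCard, Finset.card_compl, r.2, Fintype.card_fin]

lemma card_kneser_vertices_eq (r : {s : Finset (Fin m) // s.card = 2}) :
    m.choose 2 = 1 + (nearVertices r).card + (farVertices r).card := by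
  rw [← card_kneser_vertices, ← Finset.card_univ, Finset.card_eq_sum_ones,
    sum_eq_root_add_near_add_far r, Finset.card_eq_sum_ones, Finset.card_eq_sum_ones]

lemma card_farVertices (hm : 2 ≤ m) (r : {s : Finset (Fin m) // s.card = 2}) :
    (farVertices r).card + 4 = 2 * m := by
  have h := card_kneser_vertices_eq r
  rw [card_nearVertices] at h
  obtain ⟨n, rfl⟩ := Nat.exists_eq_add_of_le' hm
  have h1 : (n + 2).choose 2 = n + 1 + (n + 1).choose 2 := by
    rw [Nat.choose_succ_succ' (n + 1) 1, Nat.choose_one_right]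
  have h2 : (n + 1).choose 2 = n + n.choose 2 := by
    rw [Nat.choose_succ_succ' n 1, Nat.choose_one_right]
  rw [Nat.add_sub_cancel] at h
  omega

lemma exists_reaches_of_le_sum (hm : 5 ≤ m) (r : {s : Finset (Fin m) // s.card = 2}) (t : ℕ) :
    ∀ C : {s : Finset (Fin m) // s.card = 2} → ℕ,
      (nearVertices r).card + (farVertices r).card + 2 * t ≤
        ∑ v ∈ nearVertices r, C v + ∑ v ∈ farVertices r, C v + 1 →
      4 * t + (farVertices r).card ≤
        ∑ v ∈ nearVertices r, C v + ∑ v ∈ farVertices r, C v + 1 →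
      ∃ C', Reaches (kneserGraph m 2) C C' ∧ C r + t ≤ C' r := by
  induction t with
  | zero => exact fun C _ _ => ⟨C, .refl, le_rfl⟩
  | succ t ih =>
    intro C h₁ h₂
    by_cases hw : ∃ w ∈ nearVertices r, 2 ≤ C w
    · obtain ⟨w, hwN, hw⟩ := hw
      have hrF := notMem_farVertices_self (r := r)
      have hrN := notMem_nearVertices_self (r := r)
      have hwF : w ∉ farVertices r := fun h => disjoint_farVertices_nearVertices h hwN
      have hwr := mem_nearVertices.mp hwN
      have hle : Pi.single w 2 ≤ C := by
        intro x
        by_cases hx : x = w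
        · subst hx; simpa using hw
        · simp [hx]
      obtain ⟨E, rfl⟩ : ∃ E, C = E + Pi.single w 2 :=
        ⟨C - Pi.single w 2, (tsub_add_cancel_of_le hle).symm⟩
      rw [sum_add_single_of_mem hwN, sum_add_single_of_notMem hwF fun x => x] at h₁ h₂
      obtain ⟨C', hC', hr⟩ := ih (E + Pi.single r 1)
        (by
          rw [sum_add_single_of_notMem hrN fun x => x, sum_add_single_of_notMem hrF fun x => x]
          omega)
        (by
          rw [sum_add_single_of_notMem hrN fun x => x, sum_add_single_of_notMem hrF fun x => x]
          omega)
      refine ⟨C', (reaches_add_single hwr E).trans hC', ?_⟩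
      simp only [Pi.add_apply, Pi.single_eq_same, Pi.single_eq_of_ne hwr.ne.symm] at hr ⊢
      omega
    · push Not at hw
      have hK : ∑ v ∈ nearVertices r, C v = ((nearVertices r).filter fun v => 0 < C v).card := by
        rw [Finset.card_filter]
        refine Finset.sum_congr rfl fun v hv => ?_
        have := hw v hv
        split_ifs <;> omega
      have hKle := Finset.card_filter_le (nearVertices r) fun v => 0 < C v
      have hpairs := sum_eq_pairs_add_card (farVertices r) C
      exact exists_reaches_of_far_pebbles hm r (t + 1) C (by omega) (by omega)

lemma solvable_stack_of_le_sum (hm : 5 ≤ m) (r : {s : Finset (Fin m) // s.card = 2}) {t : ℕ}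
    {C : {s : Finset (Fin m) // s.card = 2} → ℕ} (h₁ : m.choose 2 + 2 * t ≤ ∑ v, C v + 2)
    (h₂ : 4 * t + 2 * m ≤ ∑ v, C v + 5) :
    Solvable (kneserGraph m 2) C (stack r t) := by
  suffices h : ∃ C', Reaches (kneserGraph m 2) C C' ∧ t ≤ C' r by
    obtain ⟨C', hC', ht⟩ := h
    refine ⟨C', hC', fun v => ?_⟩
    by_cases hv : v = r
    · simpa [stack, hv] using ht
    · simp [stack, hv]
  rcases le_total t (C r) with ht | ht
  · exact ⟨C, .refl, ht⟩
  have hcard := card_kneser_vertices_eq r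
  have hfar := card_farVertices (by omega) r
  rw [sum_eq_root_add_near_add_far r] at h₁ h₂
  obtain ⟨C', hC', h⟩ := exists_reaches_of_le_sum hm r (t - C r) C (by omega) (by omega)
  exact ⟨C', hC', by omega⟩

lemma exists_not_solvable_of_lt_choose (hm : 5 ≤ m) (r : {s : Finset (Fin m) // s.card = 2})
    {t M : ℕ} (ht : 1 ≤ t) (hM : M + 2 < m.choose 2 + 2 * t) :
    ∃ C, ∑ v, C v = M ∧ ¬ Solvable (kneserGraph m 2) C (stack r t) := by
  have hcard := card_kneser_vertices_eq r
  have hfar := card_farVertices (by omega) r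
  obtain ⟨u, hu⟩ : (farVertices r).Nonempty := Finset.card_pos.mp (by omega)
  have hur : u ≠ r := (mem_farVertices.mp hu).1
  refine exists_not_solvable (f := fun v c => if v = r then c else c / 2)
    (D := fun v => (if v = r then 0 else 1) + if v = u then 2 * t - 2 else 0) ?_ ?_ ?_ ?_
  · intro v a b hab
    dsimp only
    split_ifs
    · exact hab
    · exact Nat.div_le_div_right hab
  · intro u v _ a b
    split_ifs <;> omega
  · calc _ = ∑ v, if v = u then t - 1 else 0 := by
          refine Finset.sum_congr rfl fun v _ => ?_
          by_cases hv : v = r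
          · subst hv; simp [hur.symm]
          · by_cases hv' : v = u
            · simp only [hv', hur, if_true, if_false]; omega
            · simp [hv, hv']
      _ < _ := by simp; omega
  · have h1 : ∑ v : {s : Finset (Fin m) // s.card = 2}, (if v = r then 0 else 1) + 1 =
        m.choose 2 := by
      rw [← card_kneser_vertices, ← Finset.card_univ, Finset.card_eq_sum_ones,
        ← Finset.add_sum_erase _ _ (Finset.mem_univ r), if_pos rfl,
        ← Finset.add_sum_erase _ (fun _ => 1) (Finset.mem_univ r), zero_add, add_comm]
      congr 1
      exact Finset.sum_congr rfl fun v hv => if_neg (Finset.ne_of_mem_erase hv)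
    rw [Finset.sum_add_distrib, Finset.sum_ite_eq']
    simp only [Finset.mem_univ, if_true]
    omega

lemma exists_not_solvable_of_lt_four_mul (hm : 5 ≤ m) (r : {s : Finset (Fin m) // s.card = 2})
    {t M : ℕ} (ht : 1 ≤ t) (hM : M + 5 < 4 * t + 2 * m) :
    ∃ C, ∑ v, C v = M ∧ ¬ Solvable (kneserGraph m 2) C (stack r t) := by
  have hfar := card_farVertices (by omega) r
  obtain ⟨u, hu⟩ : (farVertices r).Nonempty := Finset.card_pos.mp (by omega)
  have hrF := notMem_farVertices_self (r := r)
  refine exists_not_solvable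
    (f := fun v c => if v = r then 2 * c else if v ∈ farVertices r then c / 2 else c)
    (D := fun v => (if v ∈ farVertices r then 1 else 0) + if v = u then 4 * t - 2 else 0)
    ?_ ?_ ?_ ?_
  · intro v a b hab
    dsimp only
    split_ifs
    · omega
    · exact Nat.div_le_div_right hab
    · exact hab
  · intro u v huv a b
    have hur : u ∈ farVertices r → v ≠ r := by
      rintro hu rfl
      exact (mem_farVertices.mp hu).2 huv
    split_ifs <;> first | omega | (exfalso; tauto)
  · calc _ = ∑ v, if v = u then 2 * t - 1 else 0 := by
          refine Finset.sum_congr rfl fun v _ => ?_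
          by_cases hv' : v = u
          · have hvr : u ≠ r := fun h => hrF (h ▸ hu)
            simp only [hv', hu, hvr, if_true, if_false]; omega
          · by_cases hv : v ∈ farVertices r
            · have hvr : v ≠ r := fun h => hrF (h ▸ hv)
              simp [hv, hv', hvr]
            · simp [hv, hv']
      _ < _ := by simp; omega
  · rw [Finset.sum_add_distrib, Finset.sum_ite_eq', ← Finset.card_filter]
    simp only [Finset.mem_univ, if_true, Finset.filter_univ_mem]
    omega

lemma pebblingNumber_kneserGraph_two (hm : 5 ≤ m) {t : ℕ} (ht : 1 ≤ t)
    (r : {s : Finset (Fin m) // s.card = 2}) :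
    pebblingNumber (kneserGraph m 2) (stack r t) =
      max (m.choose 2 + 2 * t - 2) (4 * t + 2 * m - 5) := by
  have hmem : ∀ C : {s : Finset (Fin m) // s.card = 2} → ℕ,
      ∑ v, C v = max (m.choose 2 + 2 * t - 2) (4 * t + 2 * m - 5) →
      Solvable (kneserGraph m 2) C (stack r t) :=
    fun C hC => solvable_stack_of_le_sum hm r (by omega) (by omega)
  refine le_antisymm (Nat.sInf_le hmem) (le_csInf ⟨_, hmem⟩ fun M hM => ?_)
  by_contra! hlt
  rcases lt_max_iff.mp hlt with h | h
  · obtain ⟨C, hC, hns⟩ := exists_not_solvable_of_lt_choose hm r ht (M := M) (by omega)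
    exact hns (hM C hC)
  · obtain ⟨C, hC, hns⟩ := exists_not_solvable_of_lt_four_mul hm r ht (M := M) (by omega)
    exact hns (hM C hC)

end Kneser

theorem kneser_tfold_formula (m t : ℕ) (hm : 5 ≤ m) (ht : 1 ≤ t) :
    tPebblingNumber (kneserGraph m 2) t =
      max (m.choose 2 + 2 * t - 2) (4 * t + 2 * m - 5) := by
  have hne : (Finset.univ : Finset {s : Finset (Fin m) // s.card = 2}).Nonempty :=
    ⟨pairVertex ⟨0, by omega⟩ ⟨1, by omega⟩ (by simp), Finset.mem_univ _⟩
  rw [tPebblingNumber, Finset.sup_congr rfl fun r _ => pebblingNumber_kneserGraph_two hm ht r,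
    Finset.sup_const hne]
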